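/- (Theorem 5.3(a), global convergence of DBA-sGS-ALM) In the DBA setting with θ ≡ 0 and θ̄_i ≡ 0, consider Algorithm DBA-sGS-ALM with penalty parameter σ > 0, step length τ ∈ (0, 2), self-adjoint positive semidefinite operators J : Y → Y and J̄ : Ȳ → Ȳ, the proximal operator S̃ = diag(0,0,J,J̄) + sGS(Q_{z̄z,y,ȳ}), and multiplier updates x^{k+1} = x^k + τσ(A*y^{k+1} + B*ȳ^{k+1} + z^{k+1} − c), x̄^{k+1} = x̄^k + τσ(B̄*ȳ^{k+1} + z̄^{k+1} − c̄). Suppose the iterates w^{k+1} = (z^{k+1}, z̄^{k+1}, y^{k+1}, ȳ^{k+1}) satisfy the perturbed proximal characterization of Lemma 5.2 with perturbation vectors Δ^k whose norms are summable over k (which holds when the error vectors of the sGS sweep are bounded in norm by a summable sequence ε_k). Assume the KKT point set is nonempty. Then the sequence (y^k, ȳ^k, z^k, z̄^k) converges to an optimal solution of the dual problem (D) (with v, v̄ absent), and (x^k, x̄^k) converges to an optimal solution of the primal problem (P). -/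

import Mathlib

/- STATEMENT 5 (Theorem 5.3(a)): global convergence of DBA-sGS-ALM (θ ≡ 0,
   θ̄ ≡ 0).  The DBA product spaces X̄, Ȳ are abstracted as finite-dimensional
   real inner product spaces `Xb`, `Yb`.  With D = diag(I, AA*+J, BB*+B̄B̄*+J̄)
   positive definite and its inverse blocks EA, Minv supplied as data, the
   S̃ = diag(0,0,J,J̄) + sGS(Q_{z̄z,y,ȳ}) quadratic form on w = (z,z̄,y,ȳ) is
     ⟨w,S̃w⟩ = ⟨Az,(AA*+J)⁻¹Az⟩ + ⟨g,M⁻¹g⟩ + ⟨y,Jy⟩ + ⟨ȳ,J̄ȳ⟩,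
   g = B̄z̄ + Bz + BA*y.  The iterates are assumed to satisfy the perturbed
   proximal characterization of Lemma 5.2 with perturbation vectors
   Δ^k = (Δzb k, Δz k, Δy k, Δyb k) of summable norms, together with the
   multiplier updates with step length τ ∈ (0,2).  Conclusion: convergence of the
   dual iterates to an optimal solution of (D) and of (x^k,x̄^k) to an optimal
   solution of (P). -/

open scoped RealInnerProductSpace
open ContinuousLinearMap (adjoint)

noncomputable section

open Classical in
def indE {E : Type*} [NormedAddCommGroup E] [InnerProductSpace ℝ E]
    (K : Set E) (x : E) : EReal := if x ∈ K then 0 else ⊤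

def conjFn {E : Type*} [NormedAddCommGroup E] [InnerProductSpace ℝ E]
    (f : E → EReal) (w : E) : EReal := ⨆ u, ((⟪w, u⟫ : ℝ) : EReal) - f u

def IsProjPt {E : Type*} [NormedAddCommGroup E] [InnerProductSpace ℝ E]
    (K : Set E) (w p : E) : Prop := p ∈ K ∧ ∀ u ∈ K, ‖w - p‖ ≤ ‖w - u‖

variable {X Y Xb Yb : Type*}
  [NormedAddCommGroup X] [InnerProductSpace ℝ X] [FiniteDimensional ℝ X]
  [NormedAddCommGroup Y] [InnerProductSpace ℝ Y] [FiniteDimensional ℝ Y]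
  [NormedAddCommGroup Xb] [InnerProductSpace ℝ Xb] [FiniteDimensional ℝ Xb]
  [NormedAddCommGroup Yb] [InnerProductSpace ℝ Yb] [FiniteDimensional ℝ Yb]

/-- The augmented Lagrangian of (D) in the ALM setting (θ ≡ 0, θ̄ ≡ 0). -/
def LsigALM (σ : ℝ) (K : Set X) (Kb : Set Xb)
    (b : Y) (bb : Yb) (c : X) (cb : Xb)
    (A : X →L[ℝ] Y) (B : X →L[ℝ] Yb) (Bb : Xb →L[ℝ] Yb)
    (z : X) (zb : Xb) (y : Y) (yb : Yb) (x : X) (xb : Xb) : EReal :=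
  conjFn (indE K) (-z) + conjFn (indE Kb) (-zb) +
  ((- ⟪b, y⟫ - ⟪bb, yb⟫ - 1/(2*σ) * ‖x‖^2 - 1/(2*σ) * ‖xb‖^2
    + σ/2 * ‖adjoint A y + adjoint B yb + z - c + σ⁻¹ • x‖^2
    + σ/2 * ‖adjoint Bb yb + zb - cb + σ⁻¹ • xb‖^2 : ℝ) : EReal)

section coreall
open Filter Topology
set_option linter.unusedSectionVars false

theorem aux_quad {a b : ℝ} (h : ∀ t : ℝ, 0 < t → t ≤ 1 → 0 ≤ t * a + t^2 * b) : 0 ≤ a := by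
  have h1 : Tendsto (fun t : ℝ => a + t * b) (𝓝[>] 0) (𝓝 (a + 0 * b)) := by
    apply Tendsto.mono_left _ nhdsWithin_le_nhds
    exact Continuous.tendsto (by fun_prop) 0
  have h2 : ∀ᶠ t : ℝ in 𝓝[>] 0, 0 ≤ a + t * b := by
    filter_upwards [Ioc_mem_nhdsGT (show (0:ℝ) < 1 by norm_num)] with t ht
    have := h t ht.1 ht.2
    have h3 : 0 ≤ t * (a + t * b) := by nlinarith
    exact nonneg_of_mul_nonneg_right h3 ht.1
  simpa using ge_of_tendsto h1 h2

theorem aux_sqrt {p s e : ℝ} (hp : 0 ≤ p) (he : 0 ≤ e)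
    (h : s^2 ≤ p^2 + 2 * e * s) : s ≤ p + 2 * e := by
  by_contra hc
  push Not at hc
  nlinarith

/-- boundedness -/
theorem aux_bdd {a δ : ℕ → ℝ} (hδ0 : ∀ k, 0 ≤ δ k) (hδ : Summable δ)
    (h : ∀ k, a (k+1) ≤ a k + δ k) : ∃ R, ∀ k, a k ≤ R := by
  refine ⟨a 0 + ∑' i, δ i, fun k => ?_⟩
  have : a k ≤ a 0 + ∑ i ∈ Finset.range k, δ i := by
    induction k with
    | zero => simp
    | succ k ih => rw [Finset.sum_range_succ]; linarith [h k]
  have h2 := hδ.sum_le_tsum (Finset.range k) (fun i _ => hδ0 i)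
  linarith

theorem aux_conv {a e d : ℕ → ℝ} (ha : ∀ k, 0 ≤ a k) (he : Summable e) (he0 : ∀ k, 0 ≤ e k)
    (hd : ∀ k, 0 ≤ d k)
    (h : ∀ k, a (k+1) + d k ≤ a k + e k) :
    (∃ l, Tendsto a atTop (𝓝 l)) ∧ Tendsto d atTop (𝓝 0) := by
  have hs := he.hasSum.tendsto_sum_nat
  have hanti : Antitone (fun k => a k - ∑ i ∈ Finset.range k, e i) := by
    apply antitone_nat_of_succ_le
    intro k
    rw [Finset.sum_range_succ]; linarith [h k, hd k]
  have hb : BddBelow (Set.range (fun k => a k - ∑ i ∈ Finset.range k, e i)) := by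
    refine ⟨-∑' i, e i, ?_⟩
    rintro _ ⟨k, rfl⟩
    have h2 := he.sum_le_tsum (Finset.range k) (fun i _ => he0 i)
    have := ha k
    simp only; linarith
  have ht := tendsto_atTop_ciInf hanti hb
  have hta := ht.add hs
  simp only [sub_add_cancel] at hta
  refine ⟨⟨_, hta⟩, ?_⟩
  have h1 := (hta.sub ((tendsto_add_atTop_iff_nat 1).2 hta)).add he.tendsto_atTop_zero
  simp only [sub_self, add_zero] at h1
  exact squeeze_zero hd (fun k => by linarith [h k]) h1

section core
variable {W P : Type*} [NormedAddCommGroup W] [NormedSpace ℝ W] [FiniteDimensional ℝ W]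
  [NormedAddCommGroup P] [InnerProductSpace ℝ P] [FiniteDimensional ℝ P]

theorem aux_coer (G : W →ₗ[ℝ] P) (S : W →ₗ[ℝ] W →ₗ[ℝ] ℝ)
    (hScont : Continuous fun p : W × W => S p.1 p.2)
    (hSpos : ∀ w, 0 ≤ S w w) (hpd : ∀ w, G w = 0 → S w w = 0 → w = 0) :
    ∃ C, 0 < C ∧ ∀ w, ‖w‖^2 ≤ C * (‖G w‖^2 + S w w) := by
  have hG := G.continuous_of_finiteDimensional
  have hq : Continuous fun w : W => ‖G w‖^2 + S w w := by
    have : Continuous fun w : W => S w w := hScont.comp (continuous_id.prodMk continuous_id)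
    fun_prop
  have : ProperSpace W := FiniteDimensional.proper_real W
  rcases (Metric.sphere (0:W) 1).eq_empty_or_nonempty with he | hne
  · refine ⟨1, one_pos, fun w => ?_⟩
    have : w = 0 := by
      by_contra hw
      have : (‖w‖⁻¹ • w) ∈ Metric.sphere (0:W) 1 := by
        simp [norm_smul, hw]
      simp [he] at this
    subst this; simp
  · obtain ⟨v, hv, hmin⟩ := (isCompact_sphere (0:W) 1).exists_isMinOn hne hq.continuousOn
    have hv1 : ‖v‖ = 1 := by simpa using hv
    have hm : 0 < ‖G v‖^2 + S v v := by
      rcases (add_nonneg (sq_nonneg ‖G v‖) (hSpos v)).lt_or_eq with h | h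
      · exact h
      · exfalso
        have h1 : ‖G v‖^2 = 0 := by nlinarith [sq_nonneg ‖G v‖, hSpos v]
        have h2 : S v v = 0 := by linarith
        have := hpd v (by simpa using h1) h2
        simp [this] at hv1
    refine ⟨(‖G v‖^2 + S v v)⁻¹, by positivity, fun w => ?_⟩
    rw [inv_mul_eq_div, le_div_iff₀ hm]
    by_cases hw : w = 0
    · simp [hw]
    have hwn : 0 < ‖w‖ := norm_pos_iff.2 hw
    have h1 : (‖w‖⁻¹ • w) ∈ Metric.sphere (0:W) 1 := by
      simp [norm_smul, hw]
    have h2 := hmin h1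
    simp only [Set.mem_ofPred_eq, map_smul, LinearMap.smul_apply, smul_eq_mul, norm_smul, norm_inv,
      norm_norm] at h2
    have h3 := mul_le_mul_of_nonneg_left h2 (sq_nonneg ‖w‖)
    refine h3.trans (le_of_eq ?_)
    field_simp

theorem aux_cs (S : W →ₗ[ℝ] W →ₗ[ℝ] ℝ) (hSsym : ∀ v w, S v w = S w v)
    (hSpos : ∀ w, 0 ≤ S w w) (v w : W) : (S v w)^2 ≤ S v v * S w w := by
  have h : ∀ t : ℝ, 0 ≤ S w w * (t * t) + (2 * S v w) * t + S v v := by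
    intro t
    have := hSpos (v + t • w)
    simp only [map_add, map_smul, LinearMap.add_apply, LinearMap.smul_apply, smul_eq_mul] at this
    rw [hSsym w v] at this
    linarith
  have := discrim_le_zero h
  rw [discrim] at this
  nlinarith

variable {ι : Type*} (D : Set W) (φ : W → ℝ) (a : ι → W →ₗ[ℝ] ℝ)
    (G : W →ₗ[ℝ] P) (d : P) (S : W →ₗ[ℝ] W →ₗ[ℝ] ℝ)
    (σ τ : ℝ) (w : ℕ → W) (l : ℕ → P) (Δ : ℕ → W →ₗ[ℝ] ℝ)

def ProxStep : Prop := ∀ k, w (k+1) ∈ D ∧ ∀ w' ∈ D,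
  φ (w (k+1)) + (σ/2) * ‖G (w (k+1)) - d + σ⁻¹ • l k‖^2
      + σ/2 * S (w (k+1) - w k) (w (k+1) - w k) - Δ k (w (k+1)) ≤
  φ w' + (σ/2) * ‖G w' - d + σ⁻¹ • l k‖^2
      + σ/2 * S (w' - w k) (w' - w k) - Δ k w'

def Saddle (ws : W) (ls : P) : Prop :=
  ws ∈ D ∧ G ws = d ∧ ∀ w' ∈ D, φ ws ≤ φ w' + ⟪ls, G w' - d⟫

variable {D φ a G d S σ τ w l Δ}

theorem core_vi (hφ : ∀ w t, (w ∈ D ∧ φ w ≤ t) ↔ ∀ i, a i w ≤ t)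
    (hSsym : ∀ v w, S v w = S w v)
    (hσ : 0 < σ) (hstep : ProxStep D φ G d S σ w l Δ) (k : ℕ) (w' : W) (hw' : w' ∈ D) :
    0 ≤ φ w' - φ (w (k+1)) + ⟪l k, G w' - G (w (k+1))⟫
      + σ * ⟪G (w (k+1)) - d, G w' - G (w (k+1))⟫
      + σ * S (w (k+1) - w k) (w' - w (k+1)) - Δ k (w' - w (k+1)) := by
  obtain ⟨h1, h2⟩ := hstep k
  apply aux_quad (b := σ/2 * (‖G w' - G (w (k+1))‖^2 + S (w' - w (k+1)) (w' - w (k+1))))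
  intro t ht0 ht1
  set u := w (k+1) with hu
  have hc : (u + t • (w' - u)) ∈ D ∧ φ (u + t • (w' - u)) ≤ (1-t) * φ u + t * φ w' := by
    rw [hφ]
    intro i
    have e1 := (hφ u (φ u)).1 ⟨h1, le_rfl⟩ i
    have e2 := (hφ w' (φ w')).1 ⟨hw', le_rfl⟩ i
    simp only [map_add, map_smul, map_sub, smul_eq_mul]
    nlinarith
  have h3 := h2 _ hc.1
  set g := G w' - G u with hg
  have e1 : G (u + t • (w' - u)) - d + σ⁻¹ • l k = (G u - d + σ⁻¹ • l k) + t • g := by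
    simp only [map_add, map_smul, map_sub, hg]; abel
  have e2 : u + t • (w' - u) - w k = (u - w k) + t • (w' - u) := by abel
  rw [e1, e2, norm_add_sq_real (G u - d + σ⁻¹ • l k) (t • g)] at h3
  simp only [map_add (Δ k), map_smul (Δ k), smul_eq_mul, inner_smul_right, inner_add_left,
    real_inner_smul_left, norm_smul, Real.norm_eq_abs, mul_pow, sq_abs] at h3
  rw [map_add S, LinearMap.add_apply, map_add (S (u - w k)), map_add (S (t • (w'-u))),
    map_smul S, LinearMap.smul_apply, LinearMap.smul_apply, map_smul, map_smul,
    hSsym (w' - u) (u - w k)] at h3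
  simp only [smul_eq_mul] at h3
  have e3 : σ / 2 * (2 * (t * (⟪G u - d, g⟫ + σ⁻¹ * ⟪l k, g⟫))) =
    t * (⟪l k, g⟫ + σ * ⟪G u - d, g⟫) := by
    field_simp; ring
  nlinarith [hc.2]

theorem core_ineq (hφ : ∀ w t, (w ∈ D ∧ φ w ≤ t) ↔ ∀ i, a i w ≤ t)
    (hSsym : ∀ v w, S v w = S w v)
    (hσ : 0 < σ) (hτ : 0 < τ) (hstep : ProxStep D φ G d S σ w l Δ)
    (hl : ∀ k, l (k+1) = l k + (τ * σ) • (G (w (k+1)) - d))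
    {ws : W} {ls : P} (hs : Saddle D φ G d ws ls) (k : ℕ) :
    (τ * σ)⁻¹ * ‖l (k+1) - ls‖^2 + σ * S (w (k+1) - ws) (w (k+1) - ws)
      + ((2 - τ) * σ * ‖G (w (k+1)) - d‖^2 + σ * S (w (k+1) - w k) (w (k+1) - w k)) ≤
    (τ * σ)⁻¹ * ‖l k - ls‖^2 + σ * S (w k - ws) (w k - ws)
      + 2 * Δ k (w (k+1) - ws) := by
  obtain ⟨hD, hG, hsd⟩ := hs
  have h1 := core_vi hφ hSsym hσ hstep k ws hD
  have h2 := hsd _ (hstep k).1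
  rw [hG] at h1
  set u := w (k+1) with hu
  set r := G u - d with hr
  have e0 : d - G u = -r := by rw [hr]; abel
  have e1 : l (k+1) - ls = (l k - ls) + (τ * σ) • r := by rw [hl k]; abel
  have e2 : ws - u = -(u - ws) := by abel
  have e3 : w k - ws = (u - ws) - (u - w k) := by abel
  rw [e0, e2, inner_neg_right, inner_neg_right, real_inner_self_eq_norm_sq] at h1
  rw [e1, norm_add_sq_real, e3]
  simp only [map_neg] at h1
  have e5 : ∀ p q : W, S (p - q) (p - q) = S p p - 2 * S q p + S q q := by
    intro p q
    simp only [map_sub, LinearMap.sub_apply, hSsym p q]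
    ring
  rw [e5 (u - ws) (u - w k)]
  rw [inner_smul_right, norm_smul, inner_sub_left, mul_pow, Real.norm_eq_abs, sq_abs]
  have e4 : (τ * σ)⁻¹ * (‖l k - ls‖ ^ 2 + 2 * (τ * σ * (⟪l k, r⟫ - ⟪ls, r⟫)) + (τ * σ) ^ 2 * ‖r‖ ^ 2)
    = (τ * σ)⁻¹ * ‖l k - ls‖^2 + 2 * (⟪l k, r⟫ - ⟪ls, r⟫) + τ * σ * ‖r‖^2 := by
    field_simp
  rw [e4]
  linarith

theorem core_bdd (hφ : ∀ w t, (w ∈ D ∧ φ w ≤ t) ↔ ∀ i, a i w ≤ t)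
    (hSsym : ∀ v w, S v w = S w v) (hSpos : ∀ w, 0 ≤ S w w)
    (hScont : Continuous fun p : W × W => S p.1 p.2)
    (hpd : ∀ w, G w = 0 → S w w = 0 → w = 0)
    (hσ : 0 < σ) (hτ : 0 < τ) (hτ2 : τ < 2) (hstep : ProxStep D φ G d S σ w l Δ)
    (hl : ∀ k, l (k+1) = l k + (τ * σ) • (G (w (k+1)) - d))
    {δ : ℕ → ℝ} (hδ0 : ∀ k, 0 ≤ δ k) (hδ : Summable δ) (hΔ : ∀ k v, |Δ k v| ≤ δ k * ‖v‖)
    {ws : W} {ls : P} (hs : Saddle D φ G d ws ls) :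
    (∃ R, ∀ k, ‖w (k+1) - ws‖ ≤ R) ∧
    (∃ R, ∀ k, ‖l k - ls‖ ≤ R) ∧
    (∃ L, Tendsto (fun k => (τ * σ)⁻¹ * ‖l k - ls‖^2 + σ * S (w k - ws) (w k - ws)) atTop (𝓝 L)) ∧
    Tendsto (fun k => ‖G (w (k+1)) - d‖^2) atTop (𝓝 0) ∧
    Tendsto (fun k => S (w (k+1) - w k) (w (k+1) - w k)) atTop (𝓝 0) := by
  obtain ⟨C, hC, hcoer⟩ := aux_coer G S hScont hSpos hpd
  have hineq := core_ineq hφ hSsym hσ hτ hstep hl hs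
  set Φ : ℕ → ℝ := fun k => (τ * σ)⁻¹ * ‖l k - ls‖^2 + σ * S (w k - ws) (w k - ws) with hΦ
  have hτσ : 0 < τ * σ := mul_pos hτ hσ
  have h2τ : 0 < (2 - τ) * σ := mul_pos (by linarith) hσ
  have hΦ1 : ∀ k, (τ * σ)⁻¹ * ‖l k - ls‖^2 ≤ Φ k := fun k => by
    have := mul_nonneg hσ.le (hSpos (w k - ws)); simp only [hΦ]; linarith
  have hΦ2 : ∀ k, σ * S (w k - ws) (w k - ws) ≤ Φ k := fun k => by
    have : 0 ≤ (τ * σ)⁻¹ * ‖l k - ls‖^2 := by positivity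
    simp only [hΦ]; linarith
  have hΦ0 : ∀ k, 0 ≤ Φ k := fun k => (mul_nonneg hσ.le (hSpos (w k - ws))).trans (hΦ2 k)
  set Ψ : ℕ → ℝ := fun k => Φ k + (2 - τ) * σ * ‖G (w k) - d‖^2 with hΨ
  have hΦΨ : ∀ k, Φ k ≤ Ψ k := fun k => by
    have : 0 ≤ (2 - τ) * σ * ‖G (w k) - d‖^2 := by positivity
    simp only [hΨ]; linarith
  have hΨ0 : ∀ k, 0 ≤ Ψ k := fun k => (hΦ0 k).trans (hΦΨ k)
  -- coercivity
  set C1 : ℝ := C * (((2 - τ) * σ)⁻¹ + σ⁻¹) with hC1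
  have hC1p : 0 < C1 := by positivity
  have hw2 : ∀ k, ‖w k - ws‖^2 ≤ C1 * Ψ k := by
    intro k
    have h1 := hcoer (w k - ws)
    rw [map_sub G, hs.2.1] at h1
    have h2 : ‖G (w k) - d‖^2 ≤ ((2 - τ) * σ)⁻¹ * Ψ k := by
      rw [inv_mul_eq_div, le_div_iff₀ h2τ]
      have := hΦ0 k
      simp only [hΨ]; linarith
    have h3 : S (w k - ws) (w k - ws) ≤ σ⁻¹ * Ψ k := by
      rw [inv_mul_eq_div, le_div_iff₀ hσ]
      linarith [hΦ2 k, hΦΨ k]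
    calc _ ≤ _ := h1
      _ ≤ C * (((2 - τ) * σ)⁻¹ * Ψ k + σ⁻¹ * Ψ k) := by gcongr
      _ = _ := by rw [hC1]; ring
  set C2 := √C1
  have hC2 : 0 ≤ C2 := Real.sqrt_nonneg _
  have hw1 : ∀ k, ‖w k - ws‖ ≤ C2 * √(Ψ k) := by
    intro k
    rw [← Real.sqrt_mul hC1p.le]
    exact Real.le_sqrt_of_sq_le (hw2 k)
  have hrec : ∀ k, √(Ψ (k+1)) ≤ √(Ψ k) + 2 * (C2 * δ k) := by
    intro k
    have h0 : √(Ψ (k+1)) ≤ √(Φ k) + 2 * (C2 * δ k) := by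
      apply aux_sqrt (Real.sqrt_nonneg _) (mul_nonneg hC2 (hδ0 k))
      rw [Real.sq_sqrt (hΨ0 _), Real.sq_sqrt (hΦ0 _)]
      have h1 := hineq k
      have h2 := (le_abs_self _).trans (hΔ k (w (k+1) - ws))
      have h3 := mul_le_mul_of_nonneg_left (hw1 (k+1)) (hδ0 k)
      have h4 := mul_nonneg hσ.le (hSpos (w (k+1) - w k))
      simp only [hΨ, hΦ] at h3 ⊢
      linarith
    have := Real.sqrt_le_sqrt (hΦΨ k)
    linarith
  obtain ⟨R, hR⟩ := aux_bdd (a := fun k => √(Ψ k)) (δ := fun k => 2 * (C2 * δ k))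
    (fun k => by have := hδ0 k; positivity) ((hδ.mul_left C2).mul_left 2) hrec
  have hR' : ∀ k, √(Ψ k) ≤ R := hR
  have hR0 : 0 ≤ R := (Real.sqrt_nonneg _).trans (hR' 0)
  have hwR : ∀ k, ‖w k - ws‖ ≤ C2 * R := fun k =>
    (hw1 k).trans (mul_le_mul_of_nonneg_left (hR' k) hC2)
  have hconv := aux_conv (a := Φ) (e := fun k => 2 * (C2 * R) * δ k)
    (d := fun k => (2 - τ) * σ * ‖G (w (k+1)) - d‖^2 + σ * S (w (k+1) - w k) (w (k+1) - w k))
    hΦ0 (hδ.mul_left _) (fun k => by have := hδ0 k; positivity)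
    (fun k => by have := hSpos (w (k+1) - w k); positivity)
    (fun k => by
      have h1 := hineq k
      have h2 := (le_abs_self _).trans (hΔ k (w (k+1) - ws))
      have h3 := mul_le_mul_of_nonneg_left (hwR (k+1)) (hδ0 k)
      simp only [hΦ]
      linarith)
  refine ⟨⟨C2 * R, fun k => hwR (k+1)⟩, ⟨√(τ * σ * R^2), fun k => ?_⟩, hconv.1, ?_, ?_⟩
  · apply Real.le_sqrt_of_sq_le
    have h1 := hΦ1 k
    rw [inv_mul_eq_div, div_le_iff₀ hτσ] at h1
    have h2 : Ψ k ≤ R^2 := by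
      rw [← Real.sq_sqrt (hΨ0 k)]
      exact pow_le_pow_left₀ (Real.sqrt_nonneg _) (hR' k) 2
    have h3 : Φ k * (τ * σ) ≤ R^2 * (τ * σ) :=
      mul_le_mul_of_nonneg_right ((hΦΨ k).trans h2) hτσ.le
    linarith
  · have := hconv.2.const_mul (((2 - τ) * σ)⁻¹)
    rw [mul_zero] at this
    refine squeeze_zero (fun k => sq_nonneg _) (fun k => ?_) this
    rw [inv_mul_eq_div, le_div_iff₀ h2τ]
    have := mul_nonneg hσ.le (hSpos (w (k+1) - w k))
    linarith
  · have := hconv.2.const_mul (σ⁻¹)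
    rw [mul_zero] at this
    refine squeeze_zero (fun k => hSpos _) (fun k => ?_) this
    rw [inv_mul_eq_div, le_div_iff₀ hσ]
    have : 0 ≤ (2 - τ) * σ * ‖G (w (k+1)) - d‖^2 := by positivity
    linarith

theorem core_conv (hφ : ∀ w t, (w ∈ D ∧ φ w ≤ t) ↔ ∀ i, a i w ≤ t)
    (hSsym : ∀ v w, S v w = S w v) (hSpos : ∀ w, 0 ≤ S w w)
    (hScont : Continuous fun p : W × W => S p.1 p.2)
    (hpd : ∀ w, G w = 0 → S w w = 0 → w = 0)
    (hσ : 0 < σ) (hτ : 0 < τ) (hτ2 : τ < 2) (hstep : ProxStep D φ G d S σ w l Δ)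
    (hl : ∀ k, l (k+1) = l k + (τ * σ) • (G (w (k+1)) - d))
    {δ : ℕ → ℝ} (hδ0 : ∀ k, 0 ≤ δ k) (hδ : Summable δ) (hΔ : ∀ k v, |Δ k v| ≤ δ k * ‖v‖)
    (hs : ∃ ws ls, Saddle D φ G d ws ls) :
    ∃ ws ls, Saddle D φ G d ws ls ∧ Tendsto w atTop (𝓝 ws) ∧ Tendsto l atTop (𝓝 ls) := by
  obtain ⟨w0, l0, hs0⟩ := hs
  obtain ⟨⟨R1, hR1⟩, ⟨R2, hR2⟩, -, hr, hdw⟩ :=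
    core_bdd hφ hSsym hSpos hScont hpd hσ hτ hτ2 hstep hl hδ0 hδ hΔ hs0
  have : ProperSpace W := FiniteDimensional.proper_real W
  have : ProperSpace P := FiniteDimensional.proper_real P
  have hcomp : IsCompact (Metric.closedBall w0 R1 ×ˢ Metric.closedBall l0 R2) :=
    (isCompact_closedBall _ _).prod (isCompact_closedBall _ _)
  obtain ⟨⟨ws, ls⟩, -, f, hf, hlim⟩ := hcomp.tendsto_subseq (x := fun k => (w (k+1), l k))
    (fun k => ⟨by simpa [dist_eq_norm] using hR1 k, by simpa [dist_eq_norm] using hR2 k⟩)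
  have hwlim : Tendsto (fun j => w (f j + 1)) atTop (𝓝 ws) :=
    (continuous_fst.tendsto _).comp hlim
  have hllim : Tendsto (fun j => l (f j)) atTop (𝓝 ls) :=
    (continuous_snd.tendsto _).comp hlim
  have hft := hf.tendsto_atTop
  have hr0 : Tendsto (fun k => G (w (k+1)) - d) atTop (𝓝 0) := by
    rw [tendsto_zero_iff_norm_tendsto_zero]
    have := (Real.continuous_sqrt.tendsto 0).comp hr
    simpa [Function.comp_def, Real.sqrt_sq] using this
  have hGc : Continuous G := G.continuous_of_finiteDimensional
  have hGs : G ws = d := by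
    have h1 : Tendsto (fun j => G (w (f j + 1)) - d) atTop (𝓝 (G ws - d)) :=
      ((hGc.tendsto ws).comp hwlim).sub_const d
    exact sub_eq_zero.1 (tendsto_nhds_unique h1 (hr0.comp hft))
  have hSdiag : Continuous fun v : W => S v v := hScont.comp (continuous_id.prodMk continuous_id)
  have key : ∀ w' ∈ D, ws ∈ D ∧ φ ws ≤ φ w' + ⟪ls, G w' - d⟫ := by
    intro w' hw'
    rw [hφ]
    intro i
    have hvi := fun j => core_vi hφ hSsym hσ hstep (f j) w' hw'
    have hai : ∀ j, a i (w (f j + 1)) ≤ φ (w (f j + 1)) := fun j =>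
      (hφ _ _).1 ⟨(hstep (f j)).1, le_rfl⟩ i
    have hac : Continuous (a i) := (a i).continuous_of_finiteDimensional
    have t1 : Tendsto (fun j => a i (w (f j + 1))) atTop (𝓝 (a i ws)) :=
      (hac.tendsto ws).comp hwlim
    have tg : Tendsto (fun j => G w' - G (w (f j + 1))) atTop (𝓝 (G w' - d)) := by
      rw [← hGs]; exact ((hGc.tendsto ws).comp hwlim).const_sub _
    have t2 : Tendsto (fun j => ⟪l (f j), G w' - G (w (f j + 1))⟫) atTop (𝓝 ⟪ls, G w' - d⟫) :=
      hllim.inner tg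
    have t3 : Tendsto (fun j => σ * ⟪G (w (f j + 1)) - d, G w' - G (w (f j + 1))⟫) atTop (𝓝 0) := by
      have := ((hr0.comp hft).inner (𝕜 := ℝ) tg).const_mul σ
      simpa using this
    have tw : Tendsto (fun j => w' - w (f j + 1)) atTop (𝓝 (w' - ws)) := hwlim.const_sub _
    have t4 : Tendsto (fun j => σ * S (w (f j+1) - w (f j)) (w' - w (f j + 1))) atTop (𝓝 0) := by
      have h1 : Tendsto (fun j => S (w (f j+1) - w (f j)) (w' - w (f j + 1))) atTop (𝓝 0) := by
        have h2 := (hdw.comp hft).mul ((hSdiag.tendsto _).comp tw)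
        rw [zero_mul] at h2
        have h3 := (Real.continuous_sqrt.tendsto 0).comp h2
        rw [Real.sqrt_zero] at h3
        refine squeeze_zero_norm (fun j => ?_) h3
        rw [Real.norm_eq_abs]
        exact Real.abs_le_sqrt (aux_cs S hSsym hSpos _ _)
      simpa using h1.const_mul σ
    have t5 : Tendsto (fun j => Δ (f j) (w' - w (f j + 1))) atTop (𝓝 0) := by
      have h1 := (hδ.tendsto_atTop_zero.comp hft).mul tw.norm
      rw [zero_mul] at h1
      exact squeeze_zero_norm (fun j => hΔ _ _) h1
    have t6 := ((((t2.const_add (φ w')).add t3).add t4).sub t5)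
    simp only [add_zero, sub_zero] at t6
    refine le_of_tendsto_of_tendsto' t1 t6 (fun j => ?_)
    linarith [hvi j, hai j]
  have hsad : Saddle D φ G d ws ls := ⟨(key w0 hs0.1).1, hGs, fun w' hw' => (key w' hw').2⟩
  refine ⟨ws, ls, hsad, ?_⟩
  obtain ⟨-, -, ⟨L, hL⟩, -, -⟩ :=
    core_bdd hφ hSsym hSpos hScont hpd hσ hτ hτ2 hstep hl hδ0 hδ hΔ hsad
  have hL0 : L = 0 := by
    have h1 := ((tendsto_add_atTop_iff_nat 1).2 hL).comp hft
    have h2 : Tendsto (fun j => l (f j + 1)) atTop (𝓝 ls) := by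
      have := hllim.add ((hr0.comp hft).const_smul (τ * σ))
      rw [smul_zero, add_zero] at this
      refine this.congr (fun j => ?_)
      rw [hl (f j)]; rfl
    have h3 := (((h2.sub_const ls).norm.pow 2).const_mul (τ * σ)⁻¹).add
      (((hSdiag.tendsto _).comp (hwlim.sub_const ws)).const_mul σ)
    simp only [sub_self, norm_zero, map_zero, mul_zero, add_zero, ne_eq, OfNat.ofNat_ne_zero,
      not_false_eq_true, zero_pow] at h3
    exact tendsto_nhds_unique h1 h3
  subst hL0
  have hτσ : 0 < τ * σ := mul_pos hτ hσ
  have hll : Tendsto (fun k => ‖l k - ls‖^2) atTop (𝓝 0) := by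
    have := hL.const_mul (τ * σ)
    rw [mul_zero] at this
    refine squeeze_zero (fun k => sq_nonneg _) (fun k => ?_) this
    have := mul_nonneg hσ.le (hSpos (w k - ws))
    rw [mul_add, mul_inv_cancel_left₀ hτσ.ne']
    nlinarith
  have hSS : Tendsto (fun k => S (w k - ws) (w k - ws)) atTop (𝓝 0) := by
    have := hL.const_mul σ⁻¹
    rw [mul_zero] at this
    refine squeeze_zero (fun k => hSpos _) (fun k => ?_) this
    rw [mul_add, inv_mul_cancel_left₀ hσ.ne']
    have : 0 ≤ σ⁻¹ * ((τ * σ)⁻¹ * ‖l k - ls‖^2) := by positivity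
    linarith
  obtain ⟨C, hC, hcoer⟩ := aux_coer G S hScont hSpos hpd
  refine ⟨?_, ?_⟩
  · rw [← tendsto_add_atTop_iff_nat 1]
    have h1 := (hr.add ((tendsto_add_atTop_iff_nat 1).2 hSS)).const_mul C
    rw [add_zero, mul_zero] at h1
    rw [tendsto_iff_norm_sub_tendsto_zero]
    have h2 := squeeze_zero (fun k => sq_nonneg (‖w (k+1) - ws‖)) (fun k => by
      have := hcoer (w (k+1) - ws)
      rw [map_sub G, hGs] at this
      exact this) h1
    have := (Real.continuous_sqrt.tendsto 0).comp h2
    simpa [Function.comp_def, Real.sqrt_sq] using this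
  · rw [tendsto_iff_norm_sub_tendsto_zero]
    have := (Real.continuous_sqrt.tendsto 0).comp hll
    simpa [Function.comp_def, Real.sqrt_sq] using this
end core
end coreall
section conc
variable {E : Type*} [NormedAddCommGroup E] [InnerProductSpace ℝ E]

theorem conj_le_iff (K : Set E) (v : E) (t : ℝ) :
    conjFn (indE K) v ≤ (t : EReal) ↔ ∀ u ∈ K, ⟪v, u⟫ ≤ t := by
  unfold conjFn indE
  rw [iSup_le_iff]
  refine forall_congr' fun u => ?_
  by_cases hu : u ∈ K
  · simp [hu]
  · simp [hu]

theorem conj_ne_bot {K : Set E} (hK : K.Nonempty) (v : E) : conjFn (indE K) v ≠ ⊥ := by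
  obtain ⟨u, hu⟩ := hK
  intro h
  have : conjFn (indE K) v ≤ ((⟪v, u⟫ - 1 : ℝ) : EReal) := by rw [h]; exact bot_le
  have := (conj_le_iff K v _).1 this u hu
  linarith

theorem conj_toReal_iff {K : Set E} (hK : K.Nonempty) (v : E) (t : ℝ) :
    (conjFn (indE K) v ≠ ⊤ ∧ (conjFn (indE K) v).toReal ≤ t) ↔ ∀ u ∈ K, ⟪v, u⟫ ≤ t := by
  rw [← conj_le_iff]
  constructor
  · rintro ⟨h1, h2⟩
    rw [← EReal.coe_toReal h1 (conj_ne_bot hK v)]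
    exact_mod_cast h2
  · intro h
    have h1 : conjFn (indE K) v ≠ ⊤ := fun h' => by
      rw [h'] at h; exact absurd h (not_le.2 (EReal.coe_lt_top t))
    refine ⟨h1, ?_⟩
    rw [← EReal.coe_toReal h1 (conj_ne_bot hK v)] at h
    exact_mod_cast h

theorem supp_sub [CompleteSpace E] {K : Set E} (hK : K.Nonempty) (hcl : IsClosed K)
    (hcv : Convex ℝ K) (zs xs : E) (h0 : conjFn (indE K) (-zs) ≠ ⊤)
    (h : ∀ z', conjFn (indE K) (-z') ≠ ⊤ →
      (conjFn (indE K) (-zs)).toReal ≤ (conjFn (indE K) (-z')).toReal + ⟪xs, z' - zs⟫) :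
    xs ∈ K ∧ ∀ u ∈ K, ⟪zs, xs⟫ ≤ ⟪zs, u⟫ := by
  constructor
  · by_contra hx
    obtain ⟨f, s, h1, h2⟩ := geometric_hahn_banach_closed_point hcv hcl hx
    set v := (InnerProductSpace.toDual ℝ E).symm f with hv
    have hf : ∀ u, f u = ⟪v, u⟫ := fun u => by
      rw [hv, InnerProductSpace.toDual_symm_apply]
    have h3 := (conj_toReal_iff hK (-zs) _).1 ⟨h0, le_rfl⟩
    have h4 := (conj_toReal_iff hK (-(zs - v)) ((conjFn (indE K) (-zs)).toReal + s)).2 (by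
      intro u hu
      have e : -(zs - v) = -zs + v := by abel
      rw [e, inner_add_left, ← hf]
      linarith [h3 u hu, h1 u hu])
    have h5 := h _ h4.1
    have e : zs - v - zs = -v := by abel
    rw [e, inner_neg_right, real_inner_comm, ← hf] at h5
    linarith [h4.2]
  · have h1 := (conj_toReal_iff hK (-(0:E)) 0).2 (by simp)
    have h2 := h 0 h1.1
    have h3 := (conj_toReal_iff hK (-zs) _).1 ⟨h0, le_rfl⟩
    intro u hu
    have h4 := h3 u hu
    rw [inner_neg_left] at h4
    rw [zero_sub, inner_neg_right, real_inner_comm] at h2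
    linarith [h1.2]

theorem proj_char {K : Set E} (hcv : Convex ℝ K) {x z : E} (h : IsProjPt K (x - z) x) :
    x ∈ K ∧ ∀ u ∈ K, ⟪-z, u⟫ ≤ ⟪-z, x⟫ := by
  obtain ⟨h1, h2⟩ := h
  refine ⟨h1, fun u hu => ?_⟩
  suffices hh : 0 ≤ 2 * ⟪z, u - x⟫ by
    rw [inner_sub_right] at hh
    rw [inner_neg_left, inner_neg_left]; linarith
  apply aux_quad (b := ‖u - x‖^2)
  intro t ht0 ht1
  have hm : x + t • (u - x) ∈ K := hcv.add_smul_sub_mem h1 hu ⟨ht0.le, ht1⟩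
  have h3 := h2 _ hm
  have e1 : x - z - x = -z := by abel
  have e2 : x - z - (x + t • (u - x)) = -(z + t • (u - x)) := by abel
  rw [e1, e2, norm_neg, norm_neg] at h3
  have h4 := pow_le_pow_left₀ (norm_nonneg _) h3 2
  rw [norm_add_sq_real, inner_smul_right, norm_smul, mul_pow, Real.norm_eq_abs, sq_abs] at h4
  linarith

theorem inv_form (T I : E →L[ℝ] E) (hT : ∀ u v, ⟪T u, v⟫ = ⟪u, T v⟫)
    (hpd : ∀ u, u ≠ 0 → 0 < ⟪u, T u⟫) (hI : T.comp I = ContinuousLinearMap.id ℝ E) :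
    (∀ u v, ⟪u, I v⟫ = ⟪v, I u⟫) ∧ (∀ u, 0 ≤ ⟪u, I u⟫) ∧ (∀ u, ⟪u, I u⟫ = 0 → u = 0) := by
  have hTI : ∀ u, T (I u) = u := fun u => by
    have := congrArg (fun f => f u) hI
    simpa using this
  have e : ∀ u, ⟪u, I u⟫ = ⟪I u, T (I u)⟫ := fun u => by rw [hTI, real_inner_comm]
  refine ⟨fun u v => ?_, fun u => ?_, fun u hu => ?_⟩
  · calc ⟪u, I v⟫ = ⟪T (I u), I v⟫ := by rw [hTI]
      _ = ⟪I u, T (I v)⟫ := hT _ _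
      _ = ⟪v, I u⟫ := by rw [hTI, real_inner_comm]
  · rw [e]
    by_cases h : I u = 0
    · simp [h]
    · exact (hpd _ h).le
  · rw [e] at hu
    by_cases h : I u = 0
    · rw [← hTI u, h, map_zero]
    · exact absurd hu (hpd _ h).ne'

theorem psd_zero [CompleteSpace E] (J : E →L[ℝ] E) (hsa : adjoint J = J) (hpsd : ∀ y, 0 ≤ ⟪y, J y⟫)
    (y : E) (h : ⟪y, J y⟫ = 0) : J y = 0 := by
  have hs : ∀ u v, ⟪J u, v⟫ = ⟪u, J v⟫ := fun u v => by
    conv_lhs => rw [← hsa]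
    rw [ContinuousLinearMap.adjoint_inner_left]
  have hh : 0 ≤ -(2 * ⟪J y, J y⟫) := by
    apply aux_quad (b := ⟪J y, J (J y)⟫)
    intro t _ _
    have := hpsd (y - t • J y)
    simp only [map_sub, map_smul, inner_sub_left, inner_sub_right, real_inner_smul_left,
      inner_smul_right] at this
    rw [h, ← hs y (J y)] at this
    linarith
  rw [← inner_self_eq_zero (𝕜 := ℝ)]
  have : 0 ≤ ⟪J y, J y⟫ := real_inner_self_nonneg
  linarith
end conc

set_option maxHeartbeats 2000000

theorem DBA_sGS_ALM_global_convergence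
    (σ : ℝ) (hσ : 0 < σ)
    (τ : ℝ) (hτ : τ ∈ Set.Ioo (0 : ℝ) 2)
    (K : Set X) (hKne : K.Nonempty) (hKcl : IsClosed K) (hKcv : Convex ℝ K)
    (Kb : Set Xb) (hKbne : Kb.Nonempty) (hKbcl : IsClosed Kb) (hKbcv : Convex ℝ Kb)
    (b : Y) (bb : Yb) (c : X) (cb : Xb)
    (A : X →L[ℝ] Y) (B : X →L[ℝ] Yb) (Bb : Xb →L[ℝ] Yb)
    (J : Y →L[ℝ] Y) (hJsa : adjoint J = J) (hJpsd : ∀ y : Y, 0 ≤ ⟪y, J y⟫)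
    (Jb : Yb →L[ℝ] Yb) (hJbsa : adjoint Jb = Jb) (hJbpsd : ∀ w : Yb, 0 ≤ ⟪w, Jb w⟫)
    (hDμpd : ∀ y : Y, y ≠ 0 → 0 < ⟪y, A (adjoint A y) + J y⟫)
    (M : Yb →L[ℝ] Yb) (hM : M = B.comp (adjoint B) + Bb.comp (adjoint Bb) + Jb)
    (hDνpd : ∀ w : Yb, w ≠ 0 → 0 < ⟪w, M w⟫)
    (EA : Y →L[ℝ] Y)
    (hEA₁ : (A.comp (adjoint A) + J).comp EA = ContinuousLinearMap.id ℝ Y)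
    (hEA₂ : EA.comp (A.comp (adjoint A) + J) = ContinuousLinearMap.id ℝ Y)
    (Minv : Yb →L[ℝ] Yb)
    (hMinv₁ : M.comp Minv = ContinuousLinearMap.id ℝ Yb)
    (hMinv₂ : Minv.comp M = ContinuousLinearMap.id ℝ Yb)
    -- the sequences generated by DBA-sGS-ALM
    (z : ℕ → X) (zb : ℕ → Xb) (y : ℕ → Y) (yb : ℕ → Yb) (x : ℕ → X) (xb : ℕ → Xb)
    -- the perturbation vectors Δ^k = (Δzb k, Δz k, Δy k, Δyb k), with summable norms
    (Δz : ℕ → X) (Δzb : ℕ → Xb) (Δy : ℕ → Y) (Δyb : ℕ → Yb)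
    (hsum : Summable fun k => ‖Δz k‖ + ‖Δzb k‖ + ‖Δy k‖ + ‖Δyb k‖)
    -- Step 1: w^{k+1} minimizes the Δ^k-perturbed proximal objective (Lemma 5.2)
    (hstep1 : ∀ k, ∀ (z' : X) (zb' : Xb) (y' : Y) (yb' : Yb),
      LsigALM σ K Kb b bb c cb A B Bb (z (k+1)) (zb (k+1)) (y (k+1)) (yb (k+1))
          (x k) (xb k) +
        ((σ/2 * (⟪A (z (k+1) - z k), EA (A (z (k+1) - z k))⟫
            + ⟪Bb (zb (k+1) - zb k) + B (z (k+1) - z k) + B (adjoint A (y (k+1) - y k)),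
                Minv (Bb (zb (k+1) - zb k) + B (z (k+1) - z k)
                  + B (adjoint A (y (k+1) - y k)))⟫
            + ⟪y (k+1) - y k, J (y (k+1) - y k)⟫
            + ⟪yb (k+1) - yb k, Jb (yb (k+1) - yb k)⟫)
          - (⟪Δz k, z (k+1)⟫ + ⟪Δzb k, zb (k+1)⟫ + ⟪Δy k, y (k+1)⟫
            + ⟪Δyb k, yb (k+1)⟫) : ℝ) : EReal) ≤
      LsigALM σ K Kb b bb c cb A B Bb z' zb' y' yb' (x k) (xb k) +
        ((σ/2 * (⟪A (z' - z k), EA (A (z' - z k))⟫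
            + ⟪Bb (zb' - zb k) + B (z' - z k) + B (adjoint A (y' - y k)),
                Minv (Bb (zb' - zb k) + B (z' - z k) + B (adjoint A (y' - y k)))⟫
            + ⟪y' - y k, J (y' - y k)⟫ + ⟪yb' - yb k, Jb (yb' - yb k)⟫)
          - (⟪Δz k, z'⟫ + ⟪Δzb k, zb'⟫ + ⟪Δy k, y'⟫ + ⟪Δyb k, yb'⟫) : ℝ) : EReal))
    -- Step 2: the multiplier updates
    (hstep2x : ∀ k, x (k+1) = x k +
      (τ * σ) • (adjoint A (y (k+1)) + adjoint B (yb (k+1)) + z (k+1) - c))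
    (hstep2xb : ∀ k, xb (k+1) = xb k +
      (τ * σ) • (adjoint Bb (yb (k+1)) + zb (k+1) - cb))
    -- the KKT point set is nonempty
    (hKKT : ∃ (x' : X) (xb' : Xb) (y' : Y) (yb' : Yb) (z' : X) (zb' : Xb),
      A x' = b ∧ B x' + Bb xb' = bb ∧
      adjoint A y' + adjoint B yb' + z' = c ∧
      adjoint Bb yb' + zb' = cb ∧
      IsProjPt K (x' - z') x' ∧ IsProjPt Kb (xb' - zb') xb') :
    ∃ (ys : Y) (ybs : Yb) (zs : X) (zbs : Xb) (xs : X) (xbs : Xb),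
      Filter.Tendsto y Filter.atTop (nhds ys) ∧
      Filter.Tendsto yb Filter.atTop (nhds ybs) ∧
      Filter.Tendsto z Filter.atTop (nhds zs) ∧
      Filter.Tendsto zb Filter.atTop (nhds zbs) ∧
      Filter.Tendsto x Filter.atTop (nhds xs) ∧
      Filter.Tendsto xb Filter.atTop (nhds xbs) ∧
      -- (ys, ybs, zs, zbs) is an optimal solution of (D)
      (adjoint A ys + adjoint B ybs + zs = c ∧
       adjoint Bb ybs + zbs = cb ∧
       ∀ (y' : Y) (yb' : Yb) (z' : X) (zb' : Xb),
         adjoint A y' + adjoint B yb' + z' = c →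
         adjoint Bb yb' + zb' = cb →
         conjFn (indE K) (-zs) + conjFn (indE Kb) (-zbs) +
           ((- ⟪b, ys⟫ - ⟪bb, ybs⟫ : ℝ) : EReal) ≤
         conjFn (indE K) (-z') + conjFn (indE Kb) (-zb') +
           ((- ⟪b, y'⟫ - ⟪bb, yb'⟫ : ℝ) : EReal)) ∧
      -- (xs, xbs) is an optimal solution of (P)
      (A xs = b ∧ B xs + Bb xbs = bb ∧
       ∀ (x' : X) (xb' : Xb), A x' = b → B x' + Bb xb' = bb →
         indE K xs + indE Kb xbs + ((⟪c, xs⟫ + ⟪cb, xbs⟫ : ℝ) : EReal) ≤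
         indE K x' + indE Kb xb' + ((⟪c, x'⟫ + ⟪cb, xb'⟫ : ℝ) : EReal)) := by
  classical
  obtain ⟨hτ0, hτ2⟩ := hτ
  -- forms
  have hJs : ∀ u v : Y, ⟪J u, v⟫ = ⟪u, J v⟫ := fun u v => by
    conv_lhs => rw [← hJsa]
    rw [ContinuousLinearMap.adjoint_inner_left]
  have hJbs : ∀ u v : Yb, ⟪Jb u, v⟫ = ⟪u, Jb v⟫ := fun u v => by
    conv_lhs => rw [← hJbsa]
    rw [ContinuousLinearMap.adjoint_inner_left]
  obtain ⟨hE1, hE2, hE3⟩ := inv_form (A.comp (adjoint A) + J) EA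
    (fun u v => by
      simp only [add_apply, ContinuousLinearMap.comp_apply, inner_add_left,
        inner_add_right, hJs, ← ContinuousLinearMap.adjoint_inner_left A,
        ← ContinuousLinearMap.adjoint_inner_right A])
    (fun u hu => by simpa using hDμpd u hu) hEA₁
  obtain ⟨hM1, hM2, hM3⟩ := inv_form M Minv
    (fun u v => by
      simp only [hM, add_apply, ContinuousLinearMap.comp_apply, inner_add_left,
        inner_add_right, hJbs, ← ContinuousLinearMap.adjoint_inner_left B,
        ← ContinuousLinearMap.adjoint_inner_right B, ← ContinuousLinearMap.adjoint_inner_left Bb,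
        ← ContinuousLinearMap.adjoint_inner_right Bb])
    hDνpd hMinv₁
  -- the abstract data
  let D : Set (X × Xb × Y × Yb) := {w | conjFn (indE K) (-w.1) ≠ ⊤ ∧ conjFn (indE Kb) (-w.2.1) ≠ ⊤}
  let φ : (X × Xb × Y × Yb) → ℝ := fun w => (conjFn (indE K) (-w.1)).toReal + (conjFn (indE Kb) (-w.2.1)).toReal
    - ⟪b, w.2.2.1⟫ - ⟪bb, w.2.2.2⟫
  let a : K × Kb → (X × Xb × Y × Yb) →ₗ[ℝ] ℝ := fun i => IsLinearMap.mk'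
    (fun w : (X × Xb × Y × Yb) => ⟪-w.1, (i.1 : X)⟫ + ⟪-w.2.1, (i.2 : Xb)⟫ - ⟪b, w.2.2.1⟫ - ⟪bb, w.2.2.2⟫)
    ⟨fun u v => by simp [inner_add_left, inner_add_right]; ring,
     fun r v => by simp [real_inner_smul_left, inner_smul_right]; ring⟩
  let G : (X × Xb × Y × Yb) →ₗ[ℝ] (WithLp 2 (X × Xb)) := IsLinearMap.mk'
    (fun w : (X × Xb × Y × Yb) => WithLp.toLp 2 (adjoint A w.2.2.1 + adjoint B w.2.2.2 + w.1,
      adjoint Bb w.2.2.2 + w.2.1))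
    ⟨fun u v => by
      rw [← WithLp.toLp_add]; congr 1
      simp only [Prod.fst_add, Prod.snd_add, map_add, Prod.mk_add_mk]
      congr 1 <;> abel,
     fun r v => by
      rw [← WithLp.toLp_smul]; congr 1
      simp only [Prod.smul_fst, Prod.smul_snd, map_smul, Prod.smul_mk, smul_add]⟩
  let d : (WithLp 2 (X × Xb)) := WithLp.toLp 2 (c, cb)
  let g : (X × Xb × Y × Yb) → Yb := fun w => Bb w.2.1 + B w.1 + B (adjoint A w.2.2.1)
  have hgadd : ∀ u v, g (u + v) = g u + g v := fun u v => by
    simp only [g, Prod.fst_add, Prod.snd_add, map_add]; abel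
  have hgsmul : ∀ (r : ℝ) v, g (r • v) = r • g v := fun r v => by
    simp only [g, Prod.smul_fst, Prod.smul_snd, map_smul, smul_add]
  let S : (X × Xb × Y × Yb) →ₗ[ℝ] (X × Xb × Y × Yb) →ₗ[ℝ] ℝ := LinearMap.mk₂ ℝ
    (fun v w : (X × Xb × Y × Yb) => ⟪A v.1, EA (A w.1)⟫ + ⟪g v, Minv (g w)⟫ + ⟪v.2.2.1, J w.2.2.1⟫
      + ⟪v.2.2.2, Jb w.2.2.2⟫)
    (fun u v w => by
      simp only [hgadd, Prod.fst_add, Prod.snd_add, map_add, inner_add_left]; ring)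
    (fun r v w => by
      simp only [hgsmul, Prod.smul_fst, Prod.smul_snd, map_smul, real_inner_smul_left, smul_eq_mul]
      ring)
    (fun u v w => by
      simp only [hgadd, Prod.fst_add, Prod.snd_add, map_add, inner_add_right]; ring)
    (fun r v w => by
      simp only [hgsmul, Prod.smul_fst, Prod.smul_snd, map_smul, inner_smul_right, smul_eq_mul]
      ring)
  let Δ : ℕ → (X × Xb × Y × Yb) →ₗ[ℝ] ℝ := fun k => IsLinearMap.mk'
    (fun w : (X × Xb × Y × Yb) => ⟪Δz k, w.1⟫ + ⟪Δzb k, w.2.1⟫ + ⟪Δy k, w.2.2.1⟫ + ⟪Δyb k, w.2.2.2⟫)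
    ⟨fun u v => by simp only [Prod.fst_add, Prod.snd_add, inner_add_right]; ring,
     fun r v => by
      simp only [Prod.smul_fst, Prod.smul_snd, inner_smul_right, smul_eq_mul]; ring⟩
  let w : ℕ → (X × Xb × Y × Yb) := fun k => (z k, zb k, y k, yb k)
  let l : ℕ → (WithLp 2 (X × Xb)) := fun k => WithLp.toLp 2 (x k, xb k)
  have hSdef : ∀ v w : (X × Xb × Y × Yb), S v w = ⟪A v.1, EA (A w.1)⟫ + ⟪g v, Minv (g w)⟫ + ⟪v.2.2.1, J w.2.2.1⟫
      + ⟪v.2.2.2, Jb w.2.2.2⟫ := fun v w => rfl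
  have hGdef : ∀ w : (X × Xb × Y × Yb), G w = WithLp.toLp 2 (adjoint A w.2.2.1 + adjoint B w.2.2.2 + w.1,
      adjoint Bb w.2.2.2 + w.2.1) := fun w => rfl
  have hadef : ∀ i w, a i w = ⟪-w.1, (i.1 : X)⟫ + ⟪-w.2.1, (i.2 : Xb)⟫ - ⟪b, w.2.2.1⟫
    - ⟪bb, w.2.2.2⟫ := fun i w => rfl
  have hΔdef : ∀ k w, Δ k w = ⟪Δz k, w.1⟫ + ⟪Δzb k, w.2.1⟫ + ⟪Δy k, w.2.2.1⟫
    + ⟪Δyb k, w.2.2.2⟫ := fun k w => rfl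
  have hφ : ∀ w t, (w ∈ D ∧ φ w ≤ t) ↔ ∀ i, a i w ≤ t := by
    intro w t
    constructor
    · rintro ⟨⟨h1, h2⟩, h3⟩ i
      have e1 := (conj_toReal_iff hKne (-w.1) _).1 ⟨h1, le_rfl⟩ i.1 i.1.2
      have e2 := (conj_toReal_iff hKbne (-w.2.1) _).1 ⟨h2, le_rfl⟩ i.2 i.2.2
      rw [hadef]
      simp only [φ] at h3
      linarith
    · intro h
      have h1 : ∀ ub ∈ Kb, conjFn (indE K) (-w.1) ≠ ⊤ ∧ (conjFn (indE K) (-w.1)).toReal ≤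
          t + ⟪b, w.2.2.1⟫ + ⟪bb, w.2.2.2⟫ - ⟪-w.2.1, ub⟫ := by
        intro ub hub
        rw [conj_toReal_iff hKne]
        intro u hu
        have := h (⟨u, hu⟩, ⟨ub, hub⟩)
        rw [hadef] at this
        simp only at this
        linarith
      have h2 := (conj_toReal_iff hKbne (-w.2.1) (t + ⟪b, w.2.2.1⟫ + ⟪bb, w.2.2.2⟫
        - (conjFn (indE K) (-w.1)).toReal)).2 (fun ub hub => by linarith [(h1 ub hub).2])
      obtain ⟨ub, hub⟩ := hKbne
      refine ⟨⟨(h1 ub hub).1, h2.1⟩, ?_⟩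
      simp only [φ]
      linarith [h2.2]
  have hSsym : ∀ v w, S v w = S w v := by
    intro v w
    rw [hSdef, hSdef, hE1 (A v.1), hM1 (g v), ← hJs, ← hJbs, real_inner_comm w.2.2.1,
      real_inner_comm w.2.2.2]
  have hSpos : ∀ w, 0 ≤ S w w := by
    intro w
    rw [hSdef]
    linarith [hE2 (A w.1), hM2 (g w), hJpsd w.2.2.1, hJbpsd w.2.2.2]
  have hScont : Continuous fun p : (X × Xb × Y × Yb) × (X × Xb × Y × Yb) => S p.1 p.2 := by
    simp only [hSdef, g]
    fun_prop
  have hpd : ∀ w, G w = 0 → S w w = 0 → w = 0 := by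
    rintro ⟨z0, zb0, y0, yb0⟩ hG0 hS0
    rw [hSdef] at hS0
    have p1 := hE2 (A z0)
    have p2 := hM2 (g (z0, zb0, y0, yb0))
    have p3 := hJpsd y0
    have p4 := hJbpsd yb0
    simp only at hS0
    have q1 := hE3 (A z0) (by linarith)
    have q2 := hM3 (g (z0, zb0, y0, yb0)) (by linarith)
    have q3 := psd_zero J hJsa hJpsd y0 (by linarith)
    have q4 := psd_zero Jb hJbsa hJbpsd yb0 (by linarith)
    have r1 : adjoint A y0 + adjoint B yb0 + z0 = 0 := congrArg (fun p : (WithLp 2 (X × Xb)) => p.fst) hG0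
    have r2 : adjoint Bb yb0 + zb0 = 0 := congrArg (fun p : (WithLp 2 (X × Xb)) => p.snd) hG0
    have s1 : z0 = -(adjoint A y0 + adjoint B yb0) := by rw [eq_neg_iff_add_eq_zero, ← r1]; abel
    have s2 : zb0 = -(adjoint Bb yb0) := by rw [eq_neg_iff_add_eq_zero, ← r2]; abel
    have hMy : M yb0 = 0 := by
      have : M yb0 = -(g (z0, zb0, y0, yb0)) := by
        simp only [g, hM, s1, s2, add_apply, ContinuousLinearMap.comp_apply,
          map_neg, map_add, q4]
        abel
      rw [this, q2, neg_zero]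
    have hyb : yb0 = 0 := by
      by_contra hne
      have := hDνpd _ hne
      rw [hMy, inner_zero_right] at this
      exact lt_irrefl _ this
    subst hyb
    have hAA : A (adjoint A y0) = 0 := by
      rw [s1] at q1
      simpa using q1
    have hy : y0 = 0 := by
      by_contra hne
      have := hDμpd _ hne
      rw [hAA, q3, add_zero, inner_zero_right] at this
      exact lt_irrefl _ this
    subst hy
    have t1 : z0 = 0 := by simpa using s1
    have t2 : zb0 = 0 := by simpa using s2
    subst t1 t2
    rfl
  have hl : ∀ k, l (k+1) = l k + (τ * σ) • (G (w (k+1)) - d) := by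
    intro k
    simp only [l, hstep2x k, hstep2xb k, hGdef, d, w, ← WithLp.toLp_sub, ← WithLp.toLp_smul,
      ← WithLp.toLp_add, Prod.mk_add_mk, Prod.mk_sub_mk, Prod.smul_mk]
  have hΔ : ∀ k v, |Δ k v| ≤ (‖Δz k‖ + ‖Δzb k‖ + ‖Δy k‖ + ‖Δyb k‖) * ‖v‖ := by
    intro k v
    rw [hΔdef]
    have n1 : ‖v.1‖ ≤ ‖v‖ := norm_fst_le v
    have n2 : ‖v.2‖ ≤ ‖v‖ := norm_snd_le v
    have n3 : ‖v.2.1‖ ≤ ‖v‖ := (norm_fst_le v.2).trans n2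
    have n4 : ‖v.2.2‖ ≤ ‖v‖ := (norm_snd_le v.2).trans n2
    have n5 : ‖v.2.2.1‖ ≤ ‖v‖ := (norm_fst_le v.2.2).trans n4
    have n6 : ‖v.2.2.2‖ ≤ ‖v‖ := (norm_snd_le v.2.2).trans n4
    have m1 := (abs_real_inner_le_norm (Δz k) v.1).trans
      (mul_le_mul_of_nonneg_left n1 (norm_nonneg _))
    have m2 := (abs_real_inner_le_norm (Δzb k) v.2.1).trans
      (mul_le_mul_of_nonneg_left n3 (norm_nonneg _))
    have m3 := (abs_real_inner_le_norm (Δy k) v.2.2.1).trans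
      (mul_le_mul_of_nonneg_left n5 (norm_nonneg _))
    have m4 := (abs_real_inner_le_norm (Δyb k) v.2.2.2).trans
      (mul_le_mul_of_nonneg_left n6 (norm_nonneg _))
    rw [add_mul, add_mul, add_mul]
    refine (abs_add_le _ _).trans (add_le_add ((abs_add_le _ _).trans (add_le_add
      ((abs_add_le _ _).trans (add_le_add m1 m2)) m3)) m4)
  -- the KKT point is a saddle point
  have hsad : ∃ ws ls, Saddle D φ G d ws ls := by
    obtain ⟨x', xb', y', yb', z', zb', k1, k2, k3, k4, k5, k6⟩ := hKKT
    obtain ⟨p1, p2⟩ := proj_char hKcv k5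
    obtain ⟨p3, p4⟩ := proj_char hKbcv k6
    have c1 := (conj_toReal_iff hKne (-z') _).2 p2
    have c2 := (conj_toReal_iff hKbne (-zb') _).2 p4
    refine ⟨(z', zb', y', yb'), WithLp.toLp 2 (x', xb'), ⟨c1.1, c2.1⟩, ?_, ?_⟩
    · rw [hGdef]; simp only [k3, k4, d]
    · rintro ⟨z1, zb1, y1, yb1⟩ ⟨d1, d2⟩
      have f1 := (conj_toReal_iff hKne (-z1) _).1 ⟨d1, le_rfl⟩ x' p1
      have f2 := (conj_toReal_iff hKbne (-zb1) _).1 ⟨d2, le_rfl⟩ xb' p3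
      simp only [φ, hGdef, d, ← WithLp.toLp_sub, WithLp.prod_inner_apply, Prod.mk_sub_mk]
      rw [← k1, ← k2, ← k3, ← k4]
      simp only [inner_add_left, inner_add_right, inner_sub_right, inner_neg_left,
        ContinuousLinearMap.adjoint_inner_right] at *
      rw [real_inner_comm x' z', real_inner_comm xb' zb'] at *
      rw [real_inner_comm x' z1] at f1
      rw [real_inner_comm xb' zb1] at f2
      linarith [c1.2, c2.2]
  -- the proximal step
  have hLtop : ∀ (z' : X) (zb' : Xb) (y' : Y) (yb' : Yb) (x' : X) (xb' : Xb) (r : ℝ),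
      ((z', zb', y', yb') : (X × Xb × Y × Yb)) ∉ D →
      LsigALM σ K Kb b bb c cb A B Bb z' zb' y' yb' x' xb' + (r : EReal) = ⊤ := by
    intro z' zb' y' yb' x' xb' r hD
    have h1 : conjFn (indE K) (-z') + conjFn (indE Kb) (-zb') = ⊤ := by
      by_cases h : conjFn (indE K) (-z') = ⊤
      · rw [h, EReal.top_add_of_ne_bot (conj_ne_bot hKbne _)]
      · by_cases h' : conjFn (indE Kb) (-zb') = ⊤
        · rw [h', EReal.add_top_of_ne_bot (conj_ne_bot hKne _)]
        · exact absurd ⟨h, h'⟩ hD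
    unfold LsigALM
    rw [h1, EReal.top_add_coe, EReal.top_add_coe]
  have hLval : ∀ (z' : X) (zb' : Xb) (y' : Y) (yb' : Yb) (x' : X) (xb' : Xb) (r : ℝ),
      ((z', zb', y', yb') : (X × Xb × Y × Yb)) ∈ D →
      LsigALM σ K Kb b bb c cb A B Bb z' zb' y' yb' x' xb' + (r : EReal) =
      ((φ (z', zb', y', yb') + σ/2 * ‖G (z', zb', y', yb') - d + σ⁻¹ • WithLp.toLp 2 (x', xb')‖^2
        + r - 1/(2*σ) * ‖x'‖^2 - 1/(2*σ) * ‖xb'‖^2 : ℝ) : EReal) := by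
    intro z' zb' y' yb' x' xb' r hD
    unfold LsigALM
    rw [← EReal.coe_toReal hD.1 (conj_ne_bot hKne _), ← EReal.coe_toReal hD.2 (conj_ne_bot hKbne _),
      ← EReal.coe_add, ← EReal.coe_add, ← EReal.coe_add, EReal.coe_eq_coe_iff]
    simp only [φ, hGdef, d, ← WithLp.toLp_sub, ← WithLp.toLp_smul, ← WithLp.toLp_add,
      WithLp.prod_norm_sq_eq_of_L2, Prod.mk_add_mk, Prod.mk_sub_mk, Prod.smul_mk,
      WithLp.toLp_fst, WithLp.toLp_snd]
    ring
  have hstep : ProxStep D φ G d S σ w l Δ := by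
    intro k
    have hD1 : w (k+1) ∈ D := by
      by_contra hn
      obtain ⟨⟨z', zb', y', yb'⟩, ls, hD', -⟩ := hsad
      have h := hstep1 k z' zb' y' yb'
      rw [hLtop _ _ _ _ _ _ _ hn, hLval _ _ _ _ _ _ _ hD'] at h
      exact absurd h (not_le.2 (EReal.coe_lt_top _))
    refine ⟨hD1, ?_⟩
    rintro ⟨z', zb', y', yb'⟩ hD'
    have h := hstep1 k z' zb' y' yb'
    rw [hLval _ _ _ _ _ _ _ hD1, hLval _ _ _ _ _ _ _ hD', EReal.coe_le_coe_iff] at h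
    rw [hSdef, hSdef, hΔdef, hΔdef]
    simp only [g, w, l, Prod.fst_sub, Prod.snd_sub] at h ⊢
    linarith
  obtain ⟨⟨zs, zbs, ys, ybs⟩, ls, ⟨hDs, hGs, hopt⟩, hwlim, hllim⟩ :=
    core_conv hφ hSsym hSpos hScont hpd hσ hτ0 hτ2 hstep hl
      (fun k => by positivity) hsum hΔ hsad
  obtain ⟨⟨xs, xbs⟩⟩ := ls
  have g1 : adjoint A ys + adjoint B ybs + zs = c := congrArg (fun p : (WithLp 2 (X × Xb)) => p.fst) hGs
  have g2 : adjoint Bb ybs + zbs = cb := congrArg (fun p : (WithLp 2 (X × Xb)) => p.snd) hGs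
  have hopt' : ∀ (z' : X) (zb' : Xb) (y' : Y) (yb' : Yb), conjFn (indE K) (-z') ≠ ⊤ →
      conjFn (indE Kb) (-zb') ≠ ⊤ →
      (conjFn (indE K) (-zs)).toReal + (conjFn (indE Kb) (-zbs)).toReal - ⟪b, ys⟫ - ⟪bb, ybs⟫ ≤
      (conjFn (indE K) (-z')).toReal + (conjFn (indE Kb) (-zb')).toReal - ⟪b, y'⟫ - ⟪bb, yb'⟫
      + (⟪xs, adjoint A y' + adjoint B yb' + z' - c⟫ + ⟪xbs, adjoint Bb yb' + zb' - cb⟫) := by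
    intro z' zb' y' yb' h1 h2
    exact hopt (z', zb', y', yb') ⟨h1, h2⟩
  have hA : A xs = b := by
    have h := hopt' zs zbs (ys - (A xs - b)) ybs hDs.1 hDs.2
    rw [← g1, ← g2] at h
    simp only [map_sub (adjoint A)] at h
    have e : (adjoint A ys - (adjoint A (A xs) - adjoint A b) + adjoint B ybs + zs -
      (adjoint A ys + adjoint B ybs + zs)) = -(adjoint A (A xs - b)) := by rw [map_sub]; abel
    rw [e, sub_self, inner_zero_right, inner_neg_right, ContinuousLinearMap.adjoint_inner_right,
      inner_sub_right b] at h
    have h2 : ⟪A xs - b, A xs - b⟫ ≤ 0 := by rw [inner_sub_left]; linarith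
    rw [← sub_eq_zero, ← inner_self_eq_zero (𝕜 := ℝ)]
    exact le_antisymm h2 real_inner_self_nonneg
  have hB : B xs + Bb xbs = bb := by
    set q := B xs + Bb xbs - bb with hq
    have h := hopt' zs zbs ys (ybs - q) hDs.1 hDs.2
    rw [← g1, ← g2] at h
    simp only [map_sub (adjoint B), map_sub (adjoint Bb)] at h
    have e : (adjoint A ys + (adjoint B ybs - adjoint B q) + zs -
      (adjoint A ys + adjoint B ybs + zs)) = -(adjoint B q) := by abel
    have e' : (adjoint Bb ybs - adjoint Bb q + zbs -
      (adjoint Bb ybs + zbs)) = -(adjoint Bb q) := by abel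
    rw [e, e', inner_neg_right, inner_neg_right, ContinuousLinearMap.adjoint_inner_right,
      ContinuousLinearMap.adjoint_inner_right, inner_sub_right bb] at h
    have h2 : ⟪q, q⟫ ≤ 0 := by
      conv_lhs => lhs; rw [hq]
      rw [inner_sub_left, inner_add_left]; linarith
    rw [← sub_eq_zero, ← hq, ← inner_self_eq_zero (𝕜 := ℝ)]
    exact le_antisymm h2 real_inner_self_nonneg
  obtain ⟨hxK, hxopt⟩ := supp_sub hKne hKcl hKcv zs xs hDs.1 (fun z' hz' => by
    have h := hopt' z' zbs ys ybs hz' hDs.2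
    rw [← g1, ← g2, sub_self, inner_zero_right, add_sub_add_left_eq_sub] at h
    linarith)
  obtain ⟨hxbK, hxbopt⟩ := supp_sub hKbne hKbcl hKbcv zbs xbs hDs.2 (fun z' hz' => by
    have h := hopt' zs z' ys ybs hDs.1 hz'
    rw [← g1, ← g2, sub_self, inner_zero_right, add_sub_add_left_eq_sub] at h
    linarith)
  refine ⟨ys, ybs, zs, zbs, xs, xbs, ?_, ?_, ?_, ?_, ?_, ?_, ⟨g1, g2, ?_⟩, hA, hB, ?_⟩
  · exact ((continuous_fst.comp (continuous_snd.comp continuous_snd)).tendsto _).comp hwlim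
  · exact ((continuous_snd.comp (continuous_snd.comp continuous_snd)).tendsto _).comp hwlim
  · exact (continuous_fst.tendsto _).comp hwlim
  · exact ((continuous_fst.comp continuous_snd).tendsto _).comp hwlim
  · exact ((continuous_fst.comp (WithLp.prod_continuous_ofLp 2 X Xb)).tendsto _).comp hllim
  · exact ((continuous_snd.comp (WithLp.prod_continuous_ofLp 2 X Xb)).tendsto _).comp hllim
  · intro y' yb' z' zb' h1 h2
    by_cases hz : conjFn (indE K) (-z') = ⊤
    · rw [hz, EReal.top_add_of_ne_bot (conj_ne_bot hKbne _), EReal.top_add_coe]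
      exact le_top
    by_cases hzb : conjFn (indE Kb) (-zb') = ⊤
    · rw [hzb, EReal.add_top_of_ne_bot (conj_ne_bot hKne _), EReal.top_add_coe]
      exact le_top
    have h := hopt' z' zb' y' yb' hz hzb
    rw [h1, h2, sub_self, sub_self, inner_zero_right, inner_zero_right] at h
    rw [← EReal.coe_toReal hz (conj_ne_bot hKne _), ← EReal.coe_toReal hzb (conj_ne_bot hKbne _),
      ← EReal.coe_toReal hDs.1 (conj_ne_bot hKne _),
      ← EReal.coe_toReal hDs.2 (conj_ne_bot hKbne _),
      ← EReal.coe_add, ← EReal.coe_add, ← EReal.coe_add, ← EReal.coe_add, EReal.coe_le_coe_iff]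
    simp only at h ⊢
    linarith
  · intro x' xb' h1 h2
    have i1 : indE K xs = 0 := by simp [indE, hxK]
    have i2 : indE Kb xbs = 0 := by simp [indE, hxbK]
    rw [i1, i2]
    by_cases hx' : x' ∈ K
    · by_cases hxb' : xb' ∈ Kb
      · have i3 : indE K x' = 0 := by simp [indE, hx']
        have i4 : indE Kb xb' = 0 := by simp [indE, hxb']
        rw [i3, i4]
        simp only [zero_add]
        rw [EReal.coe_le_coe_iff, ← g1, ← g2]
        simp only [inner_add_left, ContinuousLinearMap.adjoint_inner_left]
        have e1 : ⟪ybs, B xs⟫ + ⟪ybs, Bb xbs⟫ = ⟪ybs, B x'⟫ + ⟪ybs, Bb xb'⟫ := by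
          rw [← inner_add_right, ← inner_add_right, hB, h2]
        rw [hA, h1]
        linarith [hxopt x' hx', hxbopt xb' hxb']
      · have i4 : indE Kb xb' = ⊤ := by simp [indE, hxb']
        have i3 : indE K x' = 0 := by simp [indE, hx']
        rw [i3, i4, zero_add ⊤, EReal.top_add_coe]
        exact le_top
    · have i3 : indE K x' = ⊤ := by simp [indE, hx']
      have i4 : indE Kb xb' ≠ ⊥ := by unfold indE; split_ifs <;> simp
      rw [i3, EReal.top_add_of_ne_bot i4, EReal.top_add_coe]
      exact le_top


end
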